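/- Let B be a content R-algebra and M a nonzero R-module. If p ∈ Ass_R(M), then the extended ideal pB belongs to Ass_B(M ⊗_R B). -/

import Mathlib

/-- The content `c(f)` of an element `f` of a commutative `R`-algebra `B`: the
intersection of all ideals `I` of `R` with `f ∈ IB`. -/
def contentIdeal (R : Type*) {B : Type*} [CommRing R] [CommRing B] [Algebra R B]
    (f : B) : Ideal R :=
  sInf {I : Ideal R | f ∈ I • (⊤ : Submodule R B)}

/-- `B` is a content `R`-algebra: (i) `f ∈ c(f)B` for all `f`; (ii) `c(rf) = r·c(f)`
and the ideal generated by all the contents is `R`; (iii) the Dedekind–Mertens content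
formula holds. -/
structure IsContentAlgebra (R B : Type*) [CommRing R] [CommRing B] [Algebra R B] : Prop where
  mem_content_smul : ∀ f : B, f ∈ contentIdeal R f • (⊤ : Submodule R B)
  content_smul : ∀ (r : R) (f : B),
    contentIdeal R (algebraMap R B r * f) = Ideal.span {r} * contentIdeal R f
  content_top : (⨆ f : B, contentIdeal R f) = ⊤
  dedekind_mertens : ∀ f g : B, ∃ n : ℕ, 1 ≤ n ∧
    contentIdeal R f ^ n * contentIdeal R g =
      contentIdeal R f ^ (n - 1) * contentIdeal R (f * g)

open scoped TensorProduct

/-- If `b` lies in the extension of the ideal of those `r` with `r • x` in the span of the `v i`,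
then `x ⊗ b` can be rewritten in terms of the `v i`. -/
theorem TensorProduct.exists_tmul_eq_sum_of_mem_colon_smul {R N P ι : Type*}
    [CommRing R] [AddCommGroup N] [Module R N] [AddCommGroup P] [Module R P]
    (v : ι → N) (s : Finset ι) (x : N) {b : P}
    (hb : b ∈ (Submodule.span R (v '' s)).colon {x} • (⊤ : Submodule R P)) :
    ∃ y : ι → P, x ⊗ₜ[R] b = ∑ i ∈ s, v i ⊗ₜ[R] y i := by
  refine Submodule.smul_induction_on hb (fun r hr g _ ↦ ?_) fun b₁ b₂ h₁ h₂ ↦ ?_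
  · obtain ⟨c, hc⟩ := (Submodule.mem_span_image_finset_iff_exists_fun' R).1
      (Submodule.mem_colon_singleton.1 hr)
    refine ⟨fun i ↦ c i • g, ?_⟩
    simp_rw [← TensorProduct.smul_tmul, ← TensorProduct.sum_tmul, hc]
  · obtain ⟨y₁, h₁⟩ := h₁
    obtain ⟨y₂, h₂⟩ := h₂
    exact ⟨y₁ + y₂, by simp [TensorProduct.tmul_add, Finset.sum_add_distrib, h₁, h₂]⟩

namespace IsContentAlgebra

variable {R B : Type*} [CommRing R] [CommRing B] [Algebra R B]

theorem mem_map_iff (hB : IsContentAlgebra R B) {I : Ideal R} {f : B} :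
    f ∈ I.map (algebraMap R B) ↔ contentIdeal R f ≤ I := by
  have h : f ∈ I.map (algebraMap R B) ↔ f ∈ I • (⊤ : Submodule R B) := by
    rw [Ideal.smul_top_eq_map, Submodule.restrictScalars_mem]
  rw [h]
  exact ⟨fun hf ↦ sInf_le hf, fun hf ↦ Submodule.smul_mono_left hf (hB.mem_content_smul f)⟩

/-- Extension of ideals to a content algebra commutes with colon by an element. -/
theorem mem_map_colon_singleton (hB : IsContentAlgebra R B) {I : Ideal R} {r : R} {f : B}
    (h : algebraMap R B r * f ∈ I.map (algebraMap R B)) :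
    f ∈ (Submodule.colon I {r}).map (algebraMap R B) := by
  rw [hB.mem_map_iff, hB.content_smul] at h
  rw [hB.mem_map_iff]
  intro s hs
  rw [Submodule.mem_colon_singleton, smul_eq_mul, mul_comm]
  exact h (Ideal.mul_mem_mul (Ideal.mem_span_singleton_self r) hs)

theorem map_isPrime (hB : IsContentAlgebra R B) {p : Ideal R} (hp : p.IsPrime) :
    (p.map (algebraMap R B)).IsPrime := by
  refine ⟨fun h ↦ hp.ne_top ?_, fun {f g} hfg ↦ ?_⟩
  · rw [eq_top_iff, ← hB.content_top]
    exact iSup_le fun f ↦ hB.mem_map_iff.1 (h ▸ Submodule.mem_top)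
  · rw [hB.mem_map_iff] at hfg ⊢
    rw [hB.mem_map_iff]
    obtain ⟨n, -, h⟩ := hB.dedekind_mertens f g
    have hle : contentIdeal R f ^ n * contentIdeal R g ≤ p := h ▸ Ideal.mul_le_right.trans hfg
    exact (hp.mul_le.1 hle).imp_left hp.le_of_pow_le

theorem sum_tmul_eq_zero (hB : IsContentAlgebra R B) {J : Ideal R} {ι : Type*} (v : ι → J)
    (s : Finset ι) (x : ι → B) (h : ∑ i ∈ s, (v i : R) • x i = 0) :
    ∑ i ∈ s, v i ⊗ₜ[R] x i = 0 := by
  classical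
  induction s using Finset.induction_on generalizing x with
  | empty => simp
  | insert a s ha ih =>
    rw [Finset.sum_insert ha] at h ⊢
    have hmem : x a ∈ (Submodule.span R (v '' s)).colon {v a} • (⊤ : Submodule R B) := by
      have hcolon : (Submodule.span R (v '' s)).colon {v a} =
          Submodule.colon (Ideal.span ((fun i ↦ (v i : R)) '' s)) {(v a : R)} := by
        ext r
        have himage : Ideal.span ((fun i ↦ (v i : R)) '' s) =
            (Submodule.span R (v '' s)).map J.subtype := by
          rw [Submodule.map_span, Set.image_image]
          rfl
        rw [Submodule.mem_colon_singleton, Submodule.mem_colon_singleton, himage]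
        exact (Function.Injective.mem_set_image (f := J.subtype)
          J.injective_subtype (s := Submodule.span R (v '' s)) (a := r • v a)).symm
      rw [hcolon, Ideal.smul_top_eq_map, Submodule.restrictScalars_mem]
      apply hB.mem_map_colon_singleton
      rw [← Algebra.smul_def, eq_neg_of_add_eq_zero_left h]
      refine neg_mem (sum_mem fun i hi ↦ ?_)
      rw [Algebra.smul_def]
      exact Ideal.mul_mem_right _ _
        (Ideal.mem_map_of_mem _ (Ideal.subset_span (Set.mem_image_of_mem _ hi)))
    obtain ⟨y, hy⟩ := TensorProduct.exists_tmul_eq_sum_of_mem_colon_smul v s (v a) hmem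
    have hy' : (v a : R) • x a = ∑ i ∈ s, (v i : R) • y i := by
      simpa using congrArg (TensorProduct.lid R B ∘ J.subtype.rTensor B) hy
    rw [hy, ← Finset.sum_add_distrib]
    simp_rw [← TensorProduct.tmul_add]
    apply ih
    simp_rw [smul_add]
    rw [Finset.sum_add_distrib, ← hy', h]

theorem flat (hB : IsContentAlgebra R B) : Module.Flat R B := by
  rw [Module.Flat.iff_rTensor_injective']
  intro J
  rw [injective_iff_map_eq_zero]
  intro t ht
  obtain ⟨s, rfl⟩ := TensorProduct.exists_finset t
  apply hB.sum_tmul_eq_zero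
  simpa using congrArg (TensorProduct.lid R B) ht

end IsContentAlgebra

/-- Annihilators of elements commute with flat base change. -/
theorem Module.Flat.bot_colon_one_tmul {R M : Type*} (B : Type*) [CommRing R] [CommRing B]
    [Algebra R B] [AddCommGroup M] [Module R M] [Module.Flat R B] (x : M) :
    (⊥ : Submodule B (B ⊗[R] M)).colon {1 ⊗ₜ x} =
      ((⊥ : Submodule R M).colon {x}).map (algebraMap R B) := by
  apply le_antisymm
  · intro b hb
    rw [Submodule.mem_colon_singleton, Submodule.mem_bot, TensorProduct.smul_tmul', smul_eq_mul,
      mul_one] at hb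
    have hker : (⊥ : Submodule R M).colon {x} =
        LinearMap.ker (LinearMap.toSpanSingleton R M x) := by
      ext r
      simp [Submodule.mem_colon_singleton]
    rw [hker]
    have hexact := Module.Flat.lTensor_exact B
      (LinearMap.exact_subtype_ker_map (LinearMap.toSpanSingleton R M x))
    obtain ⟨t, ht⟩ := (hexact (b ⊗ₜ 1)).1 (by simpa using hb)
    have hb' := congrArg (TensorProduct.rid R B) ht
    rw [TensorProduct.rid_tmul, one_smul] at hb'
    rw [← hb']
    clear hb' ht hb
    induction t with
    | zero => simp
    | add t₁ t₂ h₁ h₂ => rw [map_add, map_add]; exact add_mem h₁ h₂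
    | tmul c r =>
      rw [LinearMap.lTensor_tmul, TensorProduct.rid_tmul, Algebra.smul_def]
      exact Ideal.mul_mem_right _ _ (Ideal.mem_map_of_mem _ r.2)
  · rw [Ideal.map_le_iff_le_comap]
    intro r hr
    rw [Submodule.mem_colon_singleton, Submodule.mem_bot] at hr
    rw [Ideal.mem_comap, Submodule.mem_colon_singleton, algebraMap_smul,
      TensorProduct.smul_tmul', TensorProduct.smul_tmul, hr, TensorProduct.tmul_zero]
    exact zero_mem _

/-- If `B` is a content `R`-algebra and `M` is a nonzero `R`-module, then every
associated prime `p` of `M` extends to an associated prime `pB` of `M ⊗_R B`. -/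
theorem associatedPrime_map_of_isContentAlgebra
    (R B M : Type*) [CommRing R] [CommRing B] [Algebra R B]
    [AddCommGroup M] [Module R M] [Nontrivial M]
    (hB : IsContentAlgebra R B) (p : Ideal R) (hp : p ∈ associatedPrimes R M) :
    p.map (algebraMap R B) ∈ associatedPrimes B (B ⊗[R] M) := by
  have := hB.flat
  obtain ⟨hprime, x, hx⟩ := hp
  have hprime' := hB.map_isPrime hprime
  refine ⟨hprime', 1 ⊗ₜ x, ?_⟩
  rw [Module.Flat.bot_colon_one_tmul]
  apply le_antisymm
  · conv_lhs => rw [hx]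
    exact Ideal.map_radical_le _
  · rw [hprime'.radical_le_iff]
    apply Ideal.map_mono
    conv_rhs => rw [hx]
    exact Ideal.le_radical
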